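/- arXiv:2312.02072 — 2 statements merged into one kernel-verified Lean document; each statement's English description precedes it below -/
import Mathlib

section
/- For all β > 0 the following inequalities hold: (i) K'(0) < 0; (ii) for every α ∈ (0,2π), |K'(α) + K'(2π−α)| < −2·K'(0); (iii) |K'(π)| < −K'(0). -/
open Real

/-- The kernel `K` of the logarithmic-spiral vortex-sheet system. -/
noncomputable def Kker (β θ : ℝ) : ℝ :=
  (1/4) * (Complex.exp ((2*((β:ℂ) - Complex.I)/(1+(β:ℂ)^2)) * ((θ:ℂ) - (Real.pi:ℂ))) /
    Complex.sin (2*(Real.pi:ℂ)*(1+Complex.I*(β:ℂ))/(1+(β:ℂ)^2))).re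

/-- The derivative `K'` of the kernel on `(0, 2π)`, given by the explicit formula;
`Kd β 0` is `K'(+0)` and `Kd β (2π)` is `K'(−0)` (the formula is continuous). -/
noncomputable def Kd (β θ : ℝ) : ℝ :=
  (2*β/(1+β^2)) * Kker β θ +
  (1/(2*(1+β^2))) * (Complex.exp ((2*((β:ℂ) - Complex.I)/(1+(β:ℂ)^2)) * ((θ:ℂ) - (Real.pi:ℂ))) /
    Complex.sin (2*(Real.pi:ℂ)*(1+Complex.I*(β:ℂ))/(1+(β:ℂ)^2))).im

/-- `K'(0) = (K'(+0) + K'(−0))/2`. -/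
noncomputable def Kd0 (β : ℝ) : ℝ := (Kd β 0 + Kd β (2*Real.pi))/2

/-- The second derivative `K''` of the kernel on `(0, 2π)`. -/
noncomputable def Kdd (β θ : ℝ) : ℝ := deriv (Kd β) θ

/-- The numerator of `K'(p) + K'(q)` for `p + q = 2π`, where `w = a - ib`. -/
noncomputable def symmNum (a b p q : ℝ) : ℝ :=
  a * (cosh (a * p) * sin (b * q) + cosh (a * q) * sin (b * p)) -
    b * (sinh (a * p) * cos (b * q) + sinh (a * q) * cos (b * p))

theorem abs_mul_sin_lt_mul_sinh {a b p : ℝ} (ha : 0 < a) (hb : 0 < b) (hp : 0 < p) :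
    |a * sin (b * p)| < b * sinh (a * p) := by
  have h1 : |sin (b * p)| ≤ b * p :=
    (abs_sin_le_abs (x := b * p)).trans_eq (abs_of_pos (by positivity))
  have h2 : a * p < sinh (a * p) := self_lt_sinh_iff.2 (by positivity)
  rw [abs_mul, abs_of_pos ha]
  nlinarith

theorem abs_symmNum_lt {a b p q : ℝ} (ha : 0 < a) (hb : 0 < b) (hp : 0 < p) (hq : 0 < q) :
    |symmNum a b p q| < b * sinh (a * (p + q)) - a * sin (b * (p + q)) := by
  have hsp := abs_lt.1 (abs_mul_sin_lt_mul_sinh ha hb hp)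
  have hsq := abs_lt.1 (abs_mul_sin_lt_mul_sinh ha hb hq)
  have hcp : 1 < cosh (a * p) := one_lt_cosh.2 (by positivity)
  have hcq : 1 < cosh (a * q) := one_lt_cosh.2 (by positivity)
  have h1 : 0 < (cosh (a * q) - cos (b * q)) * (b * sinh (a * p) + a * sin (b * p)) :=
    mul_pos (by linarith [cos_le_one (b * q)]) (by linarith [hsp.1])
  have h2 : 0 < (cosh (a * p) - cos (b * p)) * (b * sinh (a * q) + a * sin (b * q)) :=
    mul_pos (by linarith [cos_le_one (b * p)]) (by linarith [hsq.1])
  have h3 : 0 < (cosh (a * q) + cos (b * q)) * (b * sinh (a * p) - a * sin (b * p)) :=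
    mul_pos (by linarith [neg_one_le_cos (b * q)]) (by linarith [hsp.2])
  have h4 : 0 < (cosh (a * p) + cos (b * p)) * (b * sinh (a * q) - a * sin (b * q)) :=
    mul_pos (by linarith [neg_one_le_cos (b * p)]) (by linarith [hsq.2])
  rw [mul_add, mul_add, sinh_add, sin_add, symmNum, abs_lt]
  constructor <;> linarith

/-- The squared modulus of `sin (πb + iπa)`. -/
noncomputable def sinNormSq (a b : ℝ) : ℝ :=
  (sin (π * b) * cosh (π * a)) ^ 2 + (cos (π * b) * sinh (π * a)) ^ 2

theorem sinNormSq_pos {a : ℝ} (b : ℝ) (ha : 0 < a) : 0 < sinNormSq a b := by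
  have h1 : 0 < sinh (π * a) := sinh_pos_iff.2 (by positivity)
  have h2 : sinNormSq a b = sin (π * b) ^ 2 + sinh (π * a) ^ 2 := by
    rw [sinNormSq]
    linear_combination sin (π * b) ^ 2 * cosh_sq (π * a) +
      sinh (π * a) ^ 2 * sin_sq_add_cos_sq (π * b)
  rw [h2]
  positivity

theorem Kd_eq (β θ a b : ℝ) (ha : a = 2 * β / (1 + β ^ 2)) (hb : b = 2 / (1 + β ^ 2)) :
    Kd β θ = exp (a * (θ - π)) *
      (a * (cos (b * (θ - π)) * (sin (π * b) * cosh (π * a)) -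
          sin (b * (θ - π)) * (cos (π * b) * sinh (π * a))) -
        b * (sin (b * (θ - π)) * (sin (π * b) * cosh (π * a)) +
          cos (b * (θ - π)) * (cos (π * b) * sinh (π * a)))) / (4 * sinNormSq a b) := by
  have hw : (2 * ((β : ℂ) - Complex.I) / (1 + (β : ℂ) ^ 2)) * ((θ : ℂ) - (π : ℂ)) =
      ((a * (θ - π) : ℝ) : ℂ) + ((-(b * (θ - π)) : ℝ) : ℂ) * Complex.I := by
    subst ha hb
    push_cast
    ring
  have hS : 2 * (π : ℂ) * (1 + Complex.I * (β : ℂ)) / (1 + (β : ℂ) ^ 2) =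
      ((π * b : ℝ) : ℂ) + ((π * a : ℝ) : ℂ) * Complex.I := by
    subst ha hb
    push_cast
    ring
  have hb' : 1 / (2 * (1 + β ^ 2)) = b / 4 := by
    rw [hb]
    field_simp
    norm_num
  have hsin : Complex.sin (((π * b : ℝ) : ℂ) + ((π * a : ℝ) : ℂ) * Complex.I) =
      ⟨sin (π * b) * cosh (π * a), cos (π * b) * sinh (π * a)⟩ := by
    rw [Complex.sin_add_mul_I, ← Complex.ofReal_sin, ← Complex.ofReal_cos, ← Complex.ofReal_sinh,
      ← Complex.ofReal_cosh]
    apply Complex.ext <;> simp [-Complex.ofReal_mul, -Complex.ofReal_sin, -Complex.ofReal_cos,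
      -Complex.ofReal_sinh, -Complex.ofReal_cosh]
  have hexp : Complex.exp (((a * (θ - π) : ℝ) : ℂ) + ((-(b * (θ - π)) : ℝ) : ℂ) * Complex.I) =
      ⟨exp (a * (θ - π)) * cos (b * (θ - π)), -(exp (a * (θ - π)) * sin (b * (θ - π)))⟩ := by
    apply Complex.ext
    · rw [Complex.exp_re]; simp
    · rw [Complex.exp_im]; simp
  rw [Kd, Kker, hw, hS, hb', ← ha, hsin, hexp, Complex.div_re, Complex.div_im, Complex.normSq_mk,
    show sin (π * b) * cosh (π * a) * (sin (π * b) * cosh (π * a)) +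
      cos (π * b) * sinh (π * a) * (cos (π * b) * sinh (π * a)) = sinNormSq a b by
        rw [sinNormSq]; ring]
  ring

theorem Kd_add_Kd (β α a b : ℝ) (ha : a = 2 * β / (1 + β ^ 2)) (hb : b = 2 / (1 + β ^ 2)) :
    Kd β α + Kd β (2 * π - α) = symmNum a b α (2 * π - α) / (4 * sinNormSq a b) := by
  rw [Kd_eq β α a b ha hb, Kd_eq β (2 * π - α) a b ha hb, ← add_div]
  congr 1
  obtain ⟨t, rfl⟩ : ∃ t, α = π + t := ⟨α - π, by ring⟩
  have e1 : a * (π + t) = π * a + a * t := by ring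
  have e2 : a * (2 * π - (π + t)) = π * a - a * t := by ring
  have e3 : b * (π + t) = π * b + b * t := by ring
  have e4 : b * (2 * π - (π + t)) = π * b - b * t := by ring
  have e5 : π + t - π = t := by ring
  have e6 : 2 * π - (π + t) - π = -t := by ring
  rw [symmNum, e1, e2, e3, e4, e5, e6, mul_neg, mul_neg, sin_neg, cos_neg, ← cosh_add_sinh (a * t),
    ← cosh_sub_sinh (a * t), cosh_add, cosh_sub, sinh_add, sinh_sub, sin_add, sin_sub, cos_add,
    cos_sub]
  ring

/-- For all `β > 0`: (i) `K'(0) < 0`; (ii) for every `α ∈ (0,2π)`,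
`|K'(α) + K'(2π−α)| < −2K'(0)`; (iii) `|K'(π)| < −K'(0)`. -/
theorem kernel_deriv_inequalities (β : ℝ) (hβ : 0 < β) :
    Kd0 β < 0 ∧
    (∀ α ∈ Set.Ioo (0:ℝ) (2*Real.pi), |Kd β α + Kd β (2*Real.pi - α)| < -2 * Kd0 β) ∧
    |Kd β Real.pi| < -Kd0 β := by
  obtain ⟨a, ha⟩ : ∃ a, a = 2 * β / (1 + β ^ 2) := ⟨_, rfl⟩
  obtain ⟨b, hb⟩ : ∃ b, b = 2 / (1 + β ^ 2) := ⟨_, rfl⟩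
  have ha0 : 0 < a := by rw [ha]; positivity
  have hb0 : 0 < b := by rw [hb]; positivity
  have hD : 0 < 4 * sinNormSq a b := mul_pos four_pos (sinNormSq_pos b ha0)
  have h0 : -2 * Kd0 β =
      (b * sinh (a * (2 * π)) - a * sin (b * (2 * π))) / (4 * sinNormSq a b) := by
    have h := Kd_add_Kd β 0 a b ha hb
    simp only [symmNum, sub_zero, mul_zero, sin_zero, cos_zero, sinh_zero, cosh_zero] at h
    rw [Kd0]
    linear_combination -h
  have hsymm : ∀ α ∈ Set.Ioo (0 : ℝ) (2 * π), |Kd β α + Kd β (2 * π - α)| < -2 * Kd0 β := by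
    rintro α ⟨hα0, hα⟩
    have h := abs_symmNum_lt ha0 hb0 hα0 (sub_pos.2 hα)
    rw [add_sub_cancel] at h
    rw [Kd_add_Kd β α a b ha hb, h0, abs_div, abs_of_pos hD]
    exact div_lt_div_of_pos_right h hD
  have hmid : |Kd β π| < -Kd0 β := by
    have h := hsymm π ⟨pi_pos, by linarith [pi_pos]⟩
    rw [show 2 * π - π = π by ring, ← two_mul, abs_mul, abs_two] at h
    linarith
  exact ⟨by linarith [abs_nonneg (Kd β π)], hsymm, hmid⟩
end

section
/- There exist constants 0 < β₀ < β₂ < β₃ such that for every β > 0 the number of solutions θ ∈ (0,2π) of the equation K_β(θ) = K_β(0) is: exactly 3 if β ∈ (0,β₀); exactly 2 if β ∈ [β₀,β₂); exactly 1 if β ∈ [β₂,β₃); and 0 if β ∈ [β₃,∞). -/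
open Real

/-- The period of the rescaled variable `x = 2θ / (1 + β²)`. -/
noncomputable def scaledPeriod (β : ℝ) : ℝ := 4 * π / (1 + β ^ 2)

/-- The slope function `(cos x - exp (-β x)) / sin x`. -/
noncomputable def kernelSlope (β x : ℝ) : ℝ := (cos x - exp (-(β * x))) / sin x

lemma scaledPeriod_pos (β : ℝ) : 0 < scaledPeriod β := by
  unfold scaledPeriod; positivity

lemma sin_ne_zero_of_mem_Ioo (j : ℕ) {x : ℝ} (hx : x ∈ Set.Ioo (j * π) ((j + 1) * π)) :
    sin x ≠ 0 := by
  have h : 0 < sin (x - j * π) :=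
    sin_pos_of_pos_of_lt_pi (by linarith [hx.1]) (by linarith [hx.2])
  rw [sin_sub_nat_mul_pi] at h
  intro h0
  simp [h0] at h

lemma cos_add_mul_sin_lt_exp {β x : ℝ} (hβ : 0 < β) (hx : 0 < x) :
    cos x + β * sin x < exp (β * x) := by
  have h1 := add_one_le_exp (β * x)
  have h2 := mul_lt_mul_of_pos_left (sin_lt hx) hβ
  linarith [cos_le_one x]

lemma hasDerivAt_kernelSlope {β x : ℝ} (hx : sin x ≠ 0) :
    HasDerivAt (kernelSlope β)
      (-(1 - exp (-(β * x)) * (cos x + β * sin x)) / sin x ^ 2) x := by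
  have h1 : HasDerivAt (fun x => exp (-(β * x))) (exp (-(β * x)) * (-(β * 1))) x :=
    (((hasDerivAt_id x).const_mul β).neg).exp
  have h2 := ((hasDerivAt_cos x).sub h1).div (hasDerivAt_sin x) hx
  refine h2.congr_deriv ?_
  congr 1
  simp only [Pi.sub_apply]
  nlinarith [sin_sq_add_cos_sq x]

lemma strictAntiOn_kernelSlope {β : ℝ} (hβ : 0 < β) (j : ℕ) :
    StrictAntiOn (kernelSlope β) (Set.Ioo (j * π) ((j + 1) * π)) := by
  refine strictAntiOn_of_deriv_neg (convex_Ioo _ _) (fun x hx =>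
    (hasDerivAt_kernelSlope (sin_ne_zero_of_mem_Ioo j hx)).continuousAt.continuousWithinAt) ?_
  intro x hx
  rw [interior_Ioo] at hx
  have hs := sin_ne_zero_of_mem_Ioo j hx
  have hx0 : 0 < x := lt_of_le_of_lt (by positivity) hx.1
  rw [(hasDerivAt_kernelSlope hs).deriv]
  apply div_neg_of_neg_of_pos _ (by positivity)
  have h := mul_lt_mul_of_pos_left (cos_add_mul_sin_lt_exp hβ hx0) (exp_pos (-(β * x)))
  rw [← exp_add, neg_add_cancel, exp_zero] at h
  linarith

lemma sin_ne_zero_of_eq {β c x : ℝ} (hβ : 0 < β) (hx : 0 < x)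
    (h : cos x - exp (-(β * x)) = c * sin x) : sin x ≠ 0 := by
  intro h0
  have h1 := sin_sq_add_cos_sq x
  have h2 : exp (-(β * x)) < 1 := exp_lt_one_iff.2 (by nlinarith)
  have h3 := exp_pos (-(β * x))
  rw [h0, mul_zero, sub_eq_zero] at h
  rw [h0, h] at h1
  nlinarith

lemma kernelSlope_eq_iff {β c x : ℝ} (hs : sin x ≠ 0) :
    kernelSlope β x = c ↔ cos x - exp (-(β * x)) = c * sin x := by
  rw [kernelSlope, div_eq_iff hs]

lemma cos_sub_mul_sin_lt_exp_neg {β x : ℝ} (hx : 0 < x) (hx' : x < π) :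
    cos x - β * sin x < exp (-(β * x)) := by
  have hd : ∀ y, HasDerivAt (fun y => exp (β * y) * (cos y - β * sin y))
      (-((1 + β ^ 2) * sin y * exp (β * y))) y := by
    intro y
    have h1 : HasDerivAt (fun y => exp (β * y)) (exp (β * y) * (β * 1)) y :=
      ((hasDerivAt_id y).const_mul β).exp
    refine (h1.mul ((hasDerivAt_cos y).sub ((hasDerivAt_sin y).const_mul β))).congr_deriv ?_
    simp only [Pi.sub_apply]
    ring
  have hanti : StrictAntiOn (fun y => exp (β * y) * (cos y - β * sin y)) (Set.Icc 0 π) := by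
    refine strictAntiOn_of_deriv_neg (convex_Icc _ _)
      (fun y _ => (hd y).continuousAt.continuousWithinAt) ?_
    intro y hy
    rw [interior_Icc] at hy
    rw [(hd y).deriv]
    have := sin_pos_of_pos_of_lt_pi hy.1 hy.2
    have : 0 < (1 + β ^ 2) * sin y * exp (β * y) := by positivity
    linarith
  have h := hanti (Set.left_mem_Icc.2 pi_pos.le) ⟨hx.le, hx'.le⟩ hx
  simp only [mul_zero, exp_zero, cos_zero, sin_zero, sub_zero, mul_one] at h
  rw [exp_neg, ← one_div, lt_div_iff₀ (exp_pos _)]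
  linarith

lemma exists_level_of_pos {β : ℝ} (hβ : 0 < β) (c : ℝ) {j : ℕ} (hj : 1 ≤ j) :
    ∃ x ∈ Set.Ioo (j * π) ((j + 1) * π), cos x - exp (-(β * x)) = c * sin x := by
  have hjπ : 0 < (j : ℝ) * π := by positivity
  let f : ℝ → ℝ := fun x => (-1) ^ j * (cos x - exp (-(β * x)) - c * sin x)
  have hf : ContinuousOn f (Set.Icc (j * π) ((j + 1) * π)) := by
    apply Continuous.continuousOn; fun_prop
  have hsq : ((-1 : ℝ) ^ j) * (-1) ^ j = 1 := by rw [← mul_pow]; simp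
  have habs : ∀ r : ℝ, 0 < r → |((-1 : ℝ) ^ j) * exp (-(β * r))| < 1 := by
    intro r hr
    rw [abs_mul, abs_pow, abs_neg, abs_one, one_pow, one_mul, abs_exp]
    exact exp_lt_one_iff.2 (by nlinarith)
  have h1 : 0 < f (j * π) := by
    have := (abs_lt.1 (habs _ hjπ)).2
    simp only [f, cos_nat_mul_pi, sin_nat_mul_pi]
    nlinarith
  have h2 : f ((j + 1) * π) < 0 := by
    have := (abs_lt.1 (habs ((j + 1) * π) (by positivity))).1
    have e1 : cos ((j + 1) * π) = (-1) ^ (j + 1) := by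
      have := cos_nat_mul_pi (j + 1); push_cast at this; exact this
    have e2 : sin ((j + 1) * π) = 0 := by
      have := sin_nat_mul_pi (j + 1); push_cast at this; exact this
    simp only [f, e1, e2, pow_succ]
    nlinarith
  obtain ⟨x, hx, hfx⟩ := intermediate_value_Ioo' (by nlinarith [pi_pos]) hf ⟨h2, h1⟩
  refine ⟨x, hx, ?_⟩
  have : (-1 : ℝ) ^ j ≠ 0 := by simp
  have h3 := (mul_eq_zero.1 hfx).resolve_left this
  linarith

lemma exists_level_zero {β c : ℝ} (hc : c < β) :
    ∃ x ∈ Set.Ioo 0 π, cos x - exp (-(β * x)) = c * sin x := by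
  let f : ℝ → ℝ := fun x => cos x - exp (-(β * x)) - c * sin x
  have hf : Continuous f := by fun_prop
  have hd : HasDerivAt f (β - c) 0 := by
    have h1 : HasDerivAt (fun x => exp (-(β * x))) (exp (-(β * 0)) * (-(β * 1))) 0 :=
      (((hasDerivAt_id (0 : ℝ)).const_mul β).neg).exp
    refine (((hasDerivAt_cos 0).sub h1).sub ((hasDerivAt_sin 0).const_mul c)).congr_deriv ?_
    simp
  obtain ⟨y, hy, hfy⟩ : ∃ y ∈ Set.Ioo 0 π, 0 < f y := by
    have h := hd.tendsto_slope_zero_right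
    have h1 := h.eventually (lt_mem_nhds (sub_pos.2 hc))
    have h2 := Ioo_mem_nhdsGT pi_pos
    obtain ⟨y, hy1, hy2⟩ := (h1.and h2).exists
    refine ⟨y, hy2, ?_⟩
    have f0 : f 0 = 0 := by simp [f]
    rw [zero_add, f0, sub_zero, smul_eq_mul] at hy1
    exact (pos_iff_pos_of_mul_pos hy1).1 (inv_pos.2 hy2.1)
  have hπ : f π < 0 := by
    simp only [f, cos_pi, sin_pi]
    linarith [exp_pos (-(β * π))]
  obtain ⟨x, hx, hfx⟩ := intermediate_value_Ioo' hy.2.le hf.continuousOn ⟨hπ, hfy⟩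
  refine ⟨x, ⟨hy.1.trans hx.1, hx.2⟩, ?_⟩
  have : f x = 0 := hfx
  simp only [f] at this
  linarith

lemma exists_mem_Ioo_mul_pi {x : ℝ} (hx : 0 < x) (hs : sin x ≠ 0) :
    ∃ j : ℕ, x ∈ Set.Ioo (j * π) ((j + 1) * π) := by
  refine ⟨⌊x / π⌋₊, ?_, ?_⟩
  · have h := Nat.floor_le (div_pos hx pi_pos).le
    rw [le_div_iff₀ pi_pos] at h
    refine lt_of_le_of_ne h ?_
    intro h'
    rw [← h'] at hs
    exact hs (sin_nat_mul_pi _)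
  · have h := Nat.lt_floor_add_one (x / π)
    rwa [div_lt_iff₀ pi_pos] at h

lemma eq_of_mem_Ioo_mul_pi {i j : ℕ} {x : ℝ} (hi : x ∈ Set.Ioo (i * π) ((i + 1) * π))
    (hj : x ∈ Set.Ioo (j * π) ((j + 1) * π)) : i = j := by
  have h1 : (i : ℝ) < j + 1 := lt_of_mul_lt_mul_right (hi.1.trans hj.2) pi_pos.le
  have h2 : (j : ℝ) < i + 1 := lt_of_mul_lt_mul_right (hj.1.trans hi.2) pi_pos.le
  norm_cast at h1 h2
  lia

/-- A level set of the slope function with exactly one point in each of the intervals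
`(jπ, (j+1)π)`, `m ≤ j < k`, and no others has `k - m` points. -/
lemma encard_level {β c : ℝ} (hβ : 0 < β) {m k : ℕ}
    (hex : ∀ j, m ≤ j → ∃ x ∈ Set.Ioo (j * π) ((j + 1) * π), cos x - exp (-(β * x)) = c * sin x)
    (hm : ∀ j < m, ∀ x ∈ Set.Ioo (j * π) ((j + 1) * π), cos x - exp (-(β * x)) ≠ c * sin x) :
    {x : ℝ | x ∈ Set.Ioo 0 (k * π) ∧ cos x - exp (-(β * x)) = c * sin x}.encard
      = (k - m : ℕ) := by
  choose! p hp hpc using hex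
  have hS : {x : ℝ | x ∈ Set.Ioo 0 (k * π) ∧ cos x - exp (-(β * x)) = c * sin x}
      = p '' (Finset.Ico m k : Finset ℕ) := by
    ext x
    simp only [Set.mem_ofPred_eq, Set.mem_image, Finset.coe_Ico, Set.mem_Ico]
    constructor
    · rintro ⟨hx, hxc⟩
      have hs := sin_ne_zero_of_eq hβ hx.1 hxc
      obtain ⟨j, hj⟩ := exists_mem_Ioo_mul_pi hx.1 hs
      have hmj : m ≤ j := by
        by_contra! h
        exact hm j h x hj hxc
      refine ⟨j, ⟨hmj, ?_⟩, ?_⟩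
      · have : (j : ℝ) < k := lt_of_mul_lt_mul_right (hj.1.trans hx.2) pi_pos.le
        exact_mod_cast this
      · refine (strictAntiOn_kernelSlope hβ j).injOn (hp j hmj) hj ?_
        rw [(kernelSlope_eq_iff hs).2 hxc,
          (kernelSlope_eq_iff (sin_ne_zero_of_mem_Ioo j (hp j hmj))).2 (hpc j hmj)]
    · rintro ⟨j, ⟨hmj, hjk⟩, rfl⟩
      refine ⟨⟨lt_of_le_of_lt (by positivity) (hp j hmj).1, (hp j hmj).2.trans_le ?_⟩, hpc j hmj⟩
      have : (j : ℝ) + 1 ≤ k := by exact_mod_cast hjk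
      gcongr
  have hinj : Set.InjOn p (Finset.Ico m k : Finset ℕ) := by
    intro i hi j hj hij
    simp only [Finset.coe_Ico, Set.mem_Ico] at hi hj
    exact eq_of_mem_Ioo_mul_pi (hp i hi.1) (hij ▸ hp j hj.1)
  rw [hS, hinj.encard_image, Set.encard_coe_eq_coe_finsetCard, Nat.card_Ico]

lemma encard_level_of_lt {β c : ℝ} (hβ : 0 < β) (hc : c < β) (k : ℕ) :
    {x : ℝ | x ∈ Set.Ioo 0 (k * π) ∧ cos x - exp (-(β * x)) = c * sin x}.encard = k := by
  refine (encard_level hβ (m := 0) (fun j _ => ?_) (by simp)).trans (by simp)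
  rcases Nat.eq_zero_or_pos j with rfl | hj
  · simpa using exists_level_zero hc
  · exact exists_level_of_pos hβ c hj

lemma encard_level_of_le {β c : ℝ} (hβ : 0 < β) (hc : β ≤ c) (k : ℕ) :
    {x : ℝ | x ∈ Set.Ioo 0 (k * π) ∧ cos x - exp (-(β * x)) = c * sin x}.encard
      = (k - 1 : ℕ) := by
  refine encard_level hβ (m := 1) (fun j hj => exists_level_of_pos hβ c hj) ?_
  intro j hj x hx h
  obtain rfl : j = 0 := by lia
  simp only [Nat.cast_zero, zero_mul, zero_add, one_mul] at hx
  have h1 := cos_sub_mul_sin_lt_exp_neg (β := β) hx.1 hx.2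
  have h2 := sin_pos_of_pos_of_lt_pi hx.1 hx.2
  nlinarith

lemma encard_sin_eq_zero (k : ℕ) :
    {x : ℝ | x ∈ Set.Ioo 0 (k * π) ∧ sin x = 0}.encard = (k - 1 : ℕ) := by
  have hS : {x : ℝ | x ∈ Set.Ioo 0 (k * π) ∧ sin x = 0}
      = (fun j : ℕ => (j : ℝ) * π) '' (Finset.Ico 1 k : Finset ℕ) := by
    ext x
    simp only [Set.mem_ofPred_eq, Set.mem_image, Finset.coe_Ico, Set.mem_Ico]
    constructor
    · rintro ⟨hx, hs⟩
      obtain ⟨n, rfl⟩ := sin_eq_zero_iff.1 hs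
      have h1 : (0 : ℝ) < n := pos_of_mul_pos_left hx.1 pi_pos.le
      have h2 : (n : ℝ) < k := lt_of_mul_lt_mul_right hx.2 pi_pos.le
      norm_cast at h1
      lift n to ℕ using h1.le
      norm_cast at h1 h2 ⊢
      exact ⟨n, ⟨h1, h2⟩, rfl⟩
    · rintro ⟨j, ⟨h1, h2⟩, rfl⟩
      have h3 : (0 : ℝ) < j := by exact_mod_cast h1
      have h4 : (j : ℝ) < k := by exact_mod_cast h2
      exact ⟨⟨by positivity, by gcongr⟩, sin_nat_mul_pi j⟩
  have hinj : Function.Injective (fun j : ℕ => (j : ℝ) * π) := fun i j h => by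
    have := mul_right_cancel₀ pi_ne_zero h
    exact_mod_cast this
  rw [hS, hinj.encard_image, Set.encard_coe_eq_coe_finsetCard, Nat.card_Ico]

lemma Kker_eq_Kker_zero_iff {β : ℝ} (hβ : 0 < β) (θ : ℝ) :
    Kker β θ = Kker β 0 ↔
      sin (scaledPeriod β) * (cos (scaledPeriod β / (2 * π) * θ)
          - exp (-(β * (scaledPeriod β / (2 * π) * θ))))
        = sin (scaledPeriod β / (2 * π) * θ)
          * (cos (scaledPeriod β) - exp (-(β * scaledPeriod β))) := by
  set L := scaledPeriod β with hL
  have hb : (1 + β ^ 2 : ℝ) ≠ 0 := by positivity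
  have hbC : (1 + (β : ℂ) ^ 2) ≠ 0 := by exact_mod_cast hb
  have hLb : L / (2 * π) = 2 / (1 + β ^ 2) := by
    rw [hL, scaledPeriod]; field_simp; norm_num
  have e2 : 2*(Real.pi:ℂ)*(1+Complex.I*(β:ℂ))/(1+(β:ℂ)^2)
      = ((L / 2 : ℝ) : ℂ) + ((β * L / 2 : ℝ) : ℂ) * Complex.I := by
    rw [hL, scaledPeriod]
    push_cast
    field_simp
    ring
  have hz : Complex.sin (2*(Real.pi:ℂ)*(1+Complex.I*(β:ℂ))/(1+(β:ℂ)^2)) ≠ 0 := by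
    rw [Ne, Complex.sin_eq_zero_iff]
    rintro ⟨n, hn⟩
    rw [e2] at hn
    have him := congrArg Complex.im hn
    simp at him
    exact him.elim hβ.ne' (scaledPeriod_pos β).ne'
  have key : ∀ t : ℝ, (Complex.exp ((2*((β:ℂ) - Complex.I)/(1+(β:ℂ)^2)) * ((t:ℂ) - (Real.pi:ℂ)))
      * (starRingEnd ℂ) (Complex.sin (2*(Real.pi:ℂ)*(1+Complex.I*(β:ℂ))/(1+(β:ℂ)^2)))).re
      = (exp (β * (L / (2 * π) * t)) * (sin (L - L / (2 * π) * t)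
        + exp (-(β * L)) * sin (L / (2 * π) * t))) / 2 := by
    intro t
    set x := L / (2 * π) * t with hx
    have e1 : (2*((β:ℂ) - Complex.I)/(1+(β:ℂ)^2)) * ((t:ℂ) - (Real.pi:ℂ))
        = ((β * (x - L / 2) : ℝ) : ℂ) + ((-(x - L / 2) : ℝ) : ℂ) * Complex.I := by
      rw [hx, hLb, hL, scaledPeriod]
      push_cast
      field_simp
      ring
    have e3 : exp (β * x) = exp (β * (x - L / 2)) * exp (β * L / 2) := by
      rw [← exp_add]; ring_nf
    have e4 : exp (-(β * L)) = exp (-(β * L / 2)) * exp (-(β * L / 2)) := by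
      rw [← exp_add]; ring_nf
    have e5 : exp (β * L / 2) * exp (-(β * L / 2)) = 1 := by
      rw [← exp_add]; simp
    have e6 : sin (L - x) = sin (L / 2) * cos (x - L / 2) - cos (L / 2) * sin (x - L / 2) := by
      rw [← sin_sub]; ring_nf
    have e7 : sin x = sin (x - L / 2) * cos (L / 2) + cos (x - L / 2) * sin (L / 2) := by
      rw [← sin_add]; ring_nf
    rw [e1, e2, Complex.exp_add_mul_I, Complex.sin_add_mul_I]
    simp only [← Complex.ofReal_exp, ← Complex.ofReal_cos, ← Complex.ofReal_sin,
      ← Complex.ofReal_cosh, ← Complex.ofReal_sinh]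
    simp only [Complex.mul_re, Complex.add_re, Complex.ofReal_re, Complex.ofReal_im,
      Complex.I_re, Complex.I_im, Complex.conj_re, Complex.conj_im, Complex.add_im,
      Complex.mul_im, cos_neg, sin_neg]
    rw [e3, e4, e6, e7, cosh_eq, sinh_eq]
    linear_combination (-(exp (β * (x - L / 2)) * exp (-(β * L / 2)) *
      (sin (x - L / 2) * cos (L / 2) + cos (x - L / 2) * sin (L / 2)) / 2)) * e5
  have hN : Complex.normSq (Complex.sin (2*(Real.pi:ℂ)*(1+Complex.I*(β:ℂ))/(1+(β:ℂ)^2))) ≠ 0 :=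
    Complex.normSq_eq_zero.not.2 hz
  have hdiv : ∀ w z : ℂ, (w / z).re = (w * (starRingEnd ℂ) z).re / Complex.normSq z := by
    intro w z
    rw [Complex.div_re, Complex.mul_re, Complex.conj_re, Complex.conj_im]
    ring
  have hexp : exp (β * (L / (2 * π) * θ)) * exp (-(β * (L / (2 * π) * θ))) = 1 := by
    rw [← exp_add]; simp
  have hpos := exp_pos (β * (L / (2 * π) * θ))
  unfold Kker
  rw [hdiv, hdiv, key, key]
  set x := L / (2 * π) * θ
  rw [mul_right_inj' (by norm_num : (1 / 4 : ℝ) ≠ 0), div_left_inj' hN,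
    div_left_inj' two_ne_zero, mul_zero, mul_zero, exp_zero, sub_zero, sin_zero, sin_sub]
  constructor
  · intro h
    apply mul_left_cancel₀ hpos.ne'
    linear_combination h - sin L * hexp
  · intro h
    linear_combination exp (β * x) * h + sin L * hexp

/-- Rescaling `θ = 2πx / L` turns the equation `Kker β θ = Kker β 0` into a trigonometric one. -/
lemma encard_solutions {β : ℝ} (hβ : 0 < β) :
    {θ : ℝ | θ ∈ Set.Ioo 0 (2 * π) ∧ Kker β θ = Kker β 0}.encard =
      {x : ℝ | x ∈ Set.Ioo 0 (scaledPeriod β) ∧ sin (scaledPeriod β) * (cos x - exp (-(β * x)))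
        = sin x * (cos (scaledPeriod β) - exp (-(β * scaledPeriod β)))}.encard := by
  have hL := scaledPeriod_pos β
  have hr : 0 < scaledPeriod β / (2 * π) := by positivity
  have hinj : Function.Injective (fun θ => scaledPeriod β / (2 * π) * θ) :=
    mul_right_injective₀ hr.ne'
  rw [← hinj.encard_image]
  congr 1
  ext x
  simp only [Set.mem_image, Set.mem_ofPred_eq, Set.mem_Ioo]
  constructor
  · rintro ⟨θ, ⟨⟨h0, h1⟩, h⟩, rfl⟩
    refine ⟨⟨by positivity, ?_⟩, (Kker_eq_Kker_zero_iff hβ θ).1 h⟩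
    calc scaledPeriod β / (2 * π) * θ < scaledPeriod β / (2 * π) * (2 * π) := by gcongr
      _ = scaledPeriod β := by field_simp
  · rintro ⟨⟨h0, h1⟩, h⟩
    have e : scaledPeriod β / (2 * π) * (2 * π / scaledPeriod β * x) = x := by field_simp
    refine ⟨2 * π / scaledPeriod β * x, ⟨⟨by positivity, ?_⟩, ?_⟩, e⟩
    · calc 2 * π / scaledPeriod β * x < 2 * π / scaledPeriod β * scaledPeriod β := by gcongr
        _ = 2 * π := by field_simp
    · rw [Kker_eq_Kker_zero_iff hβ, e]
      exact h

/-- The slope function at the scaled period, compared with its limit `β` at `0`. -/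
noncomputable def slopeGap (β : ℝ) : ℝ := kernelSlope β (scaledPeriod β) - β

lemma encard_solutions_eq_level {β : ℝ} (hβ : 0 < β) {k : ℕ}
    (hk : scaledPeriod β ∈ Set.Ioo (k * π) ((k + 1) * π)) :
    {θ : ℝ | θ ∈ Set.Ioo 0 (2 * π) ∧ Kker β θ = Kker β 0}.encard =
      {x : ℝ | x ∈ Set.Ioo 0 (k * π) ∧
        cos x - exp (-(β * x)) = kernelSlope β (scaledPeriod β) * sin x}.encard := by
  rw [encard_solutions hβ]
  congr 1
  set L := scaledPeriod β
  have hs := sin_ne_zero_of_mem_Ioo k hk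
  have hiff : ∀ x, sin L * (cos x - exp (-(β * x))) = sin x * (cos L - exp (-(β * L))) ↔
      cos x - exp (-(β * x)) = kernelSlope β L * sin x := by
    intro x
    rw [kernelSlope, div_mul_eq_mul_div, eq_div_iff hs, mul_comm (sin L), mul_comm (sin x)]
  ext x
  simp only [Set.mem_ofPred_eq, hiff]
  constructor
  · rintro ⟨hx, h⟩
    refine ⟨⟨hx.1, ?_⟩, h⟩
    have hsx := sin_ne_zero_of_eq hβ hx.1 h
    by_contra! hle
    have hne : (k : ℝ) * π ≠ x := by
      rintro rfl
      exact hsx (sin_nat_mul_pi k)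
    have hanti := strictAntiOn_kernelSlope hβ k ⟨lt_of_le_of_ne hle hne, hx.2.trans hk.2⟩ hk hx.2
    rw [(kernelSlope_eq_iff hsx).2 h] at hanti
    exact lt_irrefl _ hanti
  · rintro ⟨hx, h⟩
    exact ⟨⟨hx.1, hx.2.trans hk.1⟩, h⟩

lemma encard_solutions_of_gap_neg {β : ℝ} (hβ : 0 < β) {k : ℕ}
    (hk : scaledPeriod β ∈ Set.Ioo (k * π) ((k + 1) * π)) (h : slopeGap β < 0) :
    {θ : ℝ | θ ∈ Set.Ioo 0 (2 * π) ∧ Kker β θ = Kker β 0}.encard = k :=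
  (encard_solutions_eq_level hβ hk).trans (encard_level_of_lt hβ (sub_neg.1 h) k)

lemma encard_solutions_of_gap_nonneg {β : ℝ} (hβ : 0 < β) {k : ℕ}
    (hk : scaledPeriod β ∈ Set.Ioo (k * π) ((k + 1) * π)) (h : 0 ≤ slopeGap β) :
    {θ : ℝ | θ ∈ Set.Ioo 0 (2 * π) ∧ Kker β θ = Kker β 0}.encard = (k - 1 : ℕ) :=
  (encard_solutions_eq_level hβ hk).trans (encard_level_of_le hβ (sub_nonneg.1 h) k)

lemma encard_solutions_of_eq_mul_pi {β : ℝ} (hβ : 0 < β) {k : ℕ}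
    (hk : scaledPeriod β = k * π) :
    {θ : ℝ | θ ∈ Set.Ioo 0 (2 * π) ∧ Kker β θ = Kker β 0}.encard = (k - 1 : ℕ) := by
  rw [encard_solutions hβ, ← encard_sin_eq_zero k]
  have hs : sin (scaledPeriod β) = 0 := by rw [hk, sin_nat_mul_pi]
  have hne : cos (scaledPeriod β) - exp (-(β * scaledPeriod β)) ≠ 0 := by
    intro h
    exact sin_ne_zero_of_eq (c := 0) hβ (scaledPeriod_pos β) (by rw [h, zero_mul]) hs
  rw [hs, hk] at *
  congr 1
  ext x
  simp only [Set.mem_ofPred_eq, zero_mul, zero_eq_mul, hne, or_false]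

/-- The numerator of `slopeGap`. -/
noncomputable def gapNumerator (β : ℝ) : ℝ :=
  cos (scaledPeriod β) - exp (-(β * scaledPeriod β)) - β * sin (scaledPeriod β)

lemma slopeGap_eq_zero {β : ℝ} (hs : sin (scaledPeriod β) ≠ 0) (h : gapNumerator β = 0) :
    slopeGap β = 0 := by
  rw [slopeGap, sub_eq_zero, kernelSlope_eq_iff hs]
  exact sub_eq_zero.1 h

lemma continuous_gapNumerator : Continuous gapNumerator := by
  have h : Continuous scaledPeriod :=
    continuous_const.div (by fun_prop) (fun β => by positivity)
  unfold gapNumerator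
  fun_prop

/-- The numerator of the derivative of `slopeGap`. -/
noncomputable def gapDerivNumerator (β : ℝ) : ℝ :=
  2 * (β * scaledPeriod β) / (1 + β ^ 2) * (1 - exp (-(β * scaledPeriod β)) *
      (cos (scaledPeriod β) + β * sin (scaledPeriod β)))
    + scaledPeriod β * exp (-(β * scaledPeriod β)) * sin (scaledPeriod β)
    - sin (scaledPeriod β) ^ 2

lemma hasDerivAt_scaledPeriod (β : ℝ) :
    HasDerivAt scaledPeriod (-(2 * (β * scaledPeriod β) / (1 + β ^ 2))) β := by
  have h : HasDerivAt (fun β : ℝ => 1 + β ^ 2) (2 * β) β := by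
    simpa using (hasDerivAt_pow 2 β).const_add 1
  refine ((hasDerivAt_const β (4 * π)).div h (by positivity)).congr_deriv ?_
  rw [scaledPeriod]
  field_simp
  ring

lemma hasDerivAt_slopeGap {β : ℝ} (hs : sin (scaledPeriod β) ≠ 0) :
    HasDerivAt slopeGap (gapDerivNumerator β / sin (scaledPeriod β) ^ 2) β := by
  have hL := hasDerivAt_scaledPeriod β
  have h := ((hL.cos.sub (((hasDerivAt_id β).mul hL).neg.exp)).div hL.sin hs).sub
    (hasDerivAt_id β)
  refine h.congr_deriv ?_
  simp only [Pi.sub_apply, Pi.mul_apply, Pi.neg_apply, id]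
  rw [gapDerivNumerator, eq_div_iff (by positivity), sub_mul, div_mul_cancel₀ _ (by positivity)]
  have := sin_sq_add_cos_sq (scaledPeriod β)
  linear_combination (2 * (β * scaledPeriod β) / (1 + β ^ 2)) * this

lemma exists_threshold {k : ℕ} {a b p q : ℝ}
    (hk : ∀ β ∈ Set.Ioo a b, scaledPeriod β ∈ Set.Ioo (k * π) ((k + 1) * π))
    (hd : ∀ β ∈ Set.Ioo a b, 0 < gapDerivNumerator β)
    (hp : p ∈ Set.Icc a b) (hq : q ∈ Set.Icc a b)
    (hFp : gapNumerator p < 0) (hFq : 0 < gapNumerator q) :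
    ∃ β₀ ∈ Set.Ioo a b, ∀ β ∈ Set.Ioo a b,
      (β < β₀ → slopeGap β < 0) ∧ (β₀ ≤ β → 0 ≤ slopeGap β) := by
  have hs : ∀ β ∈ Set.Ioo a b, sin (scaledPeriod β) ≠ 0 :=
    fun β hβ => sin_ne_zero_of_mem_Ioo k (hk β hβ)
  have hmono : StrictMonoOn slopeGap (Set.Ioo a b) := by
    refine strictMonoOn_of_deriv_pos (convex_Ioo _ _) (fun β hβ =>
      (hasDerivAt_slopeGap (hs β hβ)).continuousAt.continuousWithinAt) ?_
    intro β hβ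
    rw [interior_Ioo] at hβ
    rw [(hasDerivAt_slopeGap (hs β hβ)).deriv]
    have := hs β hβ
    have := hd β hβ
    positivity
  obtain ⟨z, hz, hFz⟩ : (0 : ℝ) ∈ gapNumerator '' Set.uIcc p q :=
    intermediate_value_uIcc continuous_gapNumerator.continuousOn
      (Set.mem_uIcc_of_le hFp.le hFq.le)
  have hzp : z ≠ p := by rintro rfl; exact hFp.ne hFz
  have hzq : z ≠ q := by rintro rfl; exact hFq.ne' hFz
  have hzab : z ∈ Set.Ioo a b := by
    rcases Set.mem_uIcc.1 hz with ⟨h1, h2⟩ | ⟨h1, h2⟩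
    · exact ⟨hp.1.trans_lt (lt_of_le_of_ne h1 hzp.symm), (lt_of_le_of_ne h2 hzq).trans_le hq.2⟩
    · exact ⟨hq.1.trans_lt (lt_of_le_of_ne h1 hzq.symm), (lt_of_le_of_ne h2 hzp).trans_le hp.2⟩
  have hgz := slopeGap_eq_zero (hs z hzab) hFz
  refine ⟨z, hzab, fun β hβ => ⟨fun h => hgz ▸ hmono hβ hzab h, fun h => ?_⟩⟩
  exact hgz ▸ hmono.monotoneOn hzab hβ h

lemma scaledPeriod_lt_iff {β t : ℝ} : scaledPeriod β < t * π ↔ 4 < t * (1 + β ^ 2) := by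
  rw [scaledPeriod, div_lt_iff₀ (by positivity), mul_right_comm, mul_lt_mul_iff_left₀ pi_pos]

lemma lt_scaledPeriod_iff {β t : ℝ} : t * π < scaledPeriod β ↔ t * (1 + β ^ 2) < 4 := by
  rw [scaledPeriod, lt_div_iff₀ (by positivity), mul_right_comm, mul_lt_mul_iff_left₀ pi_pos]

lemma scaledPeriod_eq_iff {β t : ℝ} : scaledPeriod β = t * π ↔ 4 = t * (1 + β ^ 2) := by
  rw [scaledPeriod, div_eq_iff (by positivity), mul_right_comm, mul_left_inj' pi_ne_zero]

lemma gapNumerator_neg_of_eq_mul_pi {β : ℝ} {k : ℕ} (hk : Odd k)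
    (h : scaledPeriod β = k * π) : gapNumerator β < 0 := by
  have := exp_pos (-(β * (k * π)))
  rw [gapNumerator, h, cos_nat_mul_pi, sin_nat_mul_pi, hk.neg_one_pow]
  linarith

lemma gapNumerator_one_pos : 0 < gapNumerator 1 := by
  have h : scaledPeriod 1 = 2 * π := by rw [scaledPeriod]; ring
  rw [gapNumerator, h, cos_two_pi, sin_two_pi]
  have : exp (-(1 * (2 * π))) < 1 := exp_lt_one_iff.2 (by linarith [pi_pos])
  linarith

lemma gapNumerator_pos_of_sq_eq {β : ℝ} (hβ : 0 < β) (h : β ^ 2 = 1 / 7) :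
    0 < gapNumerator β := by
  have hL : scaledPeriod β = (7 / 2) * π := by rw [scaledPeriod_eq_iff, h]; norm_num
  have e : (7 / 2) * π = (π / 2 + π) + 2 * π := by ring
  have hc : cos (scaledPeriod β) = 0 := by
    rw [hL, e, cos_add_two_pi, cos_add_pi, cos_pi_div_two, neg_zero]
  have hs : sin (scaledPeriod β) = -1 := by
    rw [hL, e, sin_add_two_pi, sin_add_pi, sin_pi_div_two]
  have hE : exp (-(β * scaledPeriod β)) < β := by
    rw [exp_neg, inv_lt_comm₀ (exp_pos _) hβ]
    have h1 := add_one_le_exp (β * scaledPeriod β)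
    have hb : β⁻¹ = 7 * β := by field_simp; linarith
    have h2 : 7 * β < β * scaledPeriod β := by rw [hL]; nlinarith [pi_gt_three]
    linarith
  rw [gapNumerator, hc, hs]
  linarith

lemma exp_neg_mul_le {u : ℝ} (hu : 0 ≤ u) : exp (-u) * (1 + u + u ^ 2 / 2) ≤ 1 := by
  have h := quadratic_le_exp_of_nonneg hu
  calc exp (-u) * (1 + u + u ^ 2 / 2) ≤ exp (-u) * exp u := by gcongr
    _ = 1 := by rw [← exp_add]; simp

lemma gapDerivNumerator_pos_of_sq_lt {β : ℝ} (hβ : 0 < β) (h : β ^ 2 < 1 / 3) :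
    0 < gapDerivNumerator β := by
  have hπ3 := pi_gt_three
  have hπ4 := pi_lt_four
  have hL0 := scaledPeriod_pos β
  have hL3 : 3 * π < scaledPeriod β := lt_scaledPeriod_iff.2 (by linarith)
  have hL4 : scaledPeriod β < 4 * π := scaledPeriod_lt_iff.2 (by nlinarith)
  have hLb : scaledPeriod β * (1 + β ^ 2) = 4 * π := by
    rw [scaledPeriod]; field_simp
  have hr : 2 * (β * scaledPeriod β) / (1 + β ^ 2)
      = scaledPeriod β / (2 * π) * (β * scaledPeriod β) := by
    rw [div_eq_iff (by positivity)]
    field_simp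
    linarith
  rw [gapDerivNumerator, hr]
  set L := scaledPeriod β
  set r := L / (2 * π) with hrdef
  have hLr : L = 2 * π * r := by rw [hrdef]; field_simp
  have hr32 : 3 / 2 < r := by rw [hrdef, lt_div_iff₀ (by positivity)]; linarith
  set u := β * L with hu
  have hu0 : 0 < u := by positivity
  have hm : 4 * π - L = β * u := by rw [hu]; linarith
  have hsin : sin L = -sin (β * u) := by
    rw [← hm, show 4 * π - L = -L + 2 * π + 2 * π by ring, sin_add_two_pi, sin_add_two_pi,
      sin_neg, neg_neg]
  have hσ0 : 0 ≤ sin (β * u) :=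
    sin_nonneg_of_nonneg_of_le_pi (by positivity) (by rw [← hm]; linarith)
  have hσu : sin (β * u) ≤ β * u := sin_le (by positivity)
  have hσ1 := sin_le_one (β * u)
  rw [hsin]
  set σ := sin (β * u)
  have hE := exp_neg_mul_le hu0.le
  have hE0 := exp_pos (-u)
  set E := exp (-u)
  have hβ1 : β < 3 / 5 := by nlinarith
  have hu9 : 9 * β < u := by rw [hu]; nlinarith
  have hu8 : u < 10 := by rw [hu]; nlinarith
  have hπβ : 2 * π * β ≤ 2 * u / 3 := by rw [hu]; nlinarith
  have hmain : β < r * (1 - E * (1 + 2 * π * β)) := by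
    have h1 : E * (1 + 2 * π * β) ≤ E * (1 + 2 * u / 3) := by gcongr
    have h2 : β < 3 / 2 * (1 - E * (1 + 2 * u / 3)) := by
      have h3 : 0 < 1 + u + u ^ 2 / 2 := by positivity
      have h4 : E ≤ 1 / (1 + u + u ^ 2 / 2) := by rwa [le_div_iff₀ h3]
      have h5 : E * (1 + 2 * u / 3) ≤ 1 / (1 + u + u ^ 2 / 2) * (1 + 2 * u / 3) := by gcongr
      have h6 : u / 9 < 3 / 2 * (1 - 1 / (1 + u + u ^ 2 / 2) * (1 + 2 * u / 3)) := by
        have e : 3 / 2 * (1 - 1 / (1 + u + u ^ 2 / 2) * (1 + 2 * u / 3))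
            = (u / 2 + 3 * u ^ 2 / 4) / (1 + u + u ^ 2 / 2) := by
          field_simp
          ring
        rw [e, lt_div_iff₀ h3]
        nlinarith [mul_pos hu0 (sub_pos.2 hu8), mul_pos hu0 (mul_pos hu0 (sub_pos.2 hu8))]
      linarith
    have h3 : 0 ≤ 1 - E * (1 + 2 * u / 3) := by linarith
    calc β < 3 / 2 * (1 - E * (1 + 2 * u / 3)) := h2
      _ ≤ r * (1 - E * (1 + 2 * π * β)) := by gcongr
  have hcos : E * cos L ≤ E := mul_le_of_le_one_right hE0.le (cos_le_one L)
  have hkey : 0 < u * (r * (1 - E * (1 + 2 * π * β)) - β) := by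
    have := sub_pos.2 hmain
    positivity
  have hLE : L * E * σ ≤ L * E * (β * u) := by gcongr
  have hσσ : σ ^ 2 ≤ β * u := by
    rw [sq]
    exact (mul_le_of_le_one_right hσ0 hσ1).trans hσu
  have hru : r * u * (E * cos L) ≤ r * u * E :=
    mul_le_mul_of_nonneg_left hcos (by positivity)
  have hpos : 0 ≤ r * u * (E * (β * σ)) := by positivity
  have e1 : L * E * (β * u) = u * (r * (E * (2 * π * β))) := by rw [hLr]; ring
  linarith

lemma gapDerivNumerator_pos_of_lt_one {β : ℝ} (hβ : 0 < β) (h : 1 / 3 < β ^ 2) (h' : β < 1) :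
    0 < gapDerivNumerator β := by
  have hπ3 := pi_gt_three
  have hL0 := scaledPeriod_pos β
  have hL2 : 2 * π < scaledPeriod β := lt_scaledPeriod_iff.2 (by nlinarith)
  have hL3 : scaledPeriod β < 3 * π := scaledPeriod_lt_iff.2 (by linarith)
  rw [gapDerivNumerator]
  set L := scaledPeriod β
  have hs : 0 ≤ sin L := by
    rw [← sin_sub_two_pi]
    exact sin_nonneg_of_nonneg_of_le_pi (by linarith) (by linarith)
  set u := β * L with hu
  have hβ2 : 1 / 2 < β := by nlinarith
  have hu3 : 3 < u := by rw [hu]; nlinarith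
  have hE := exp_neg_mul_le (u := u) (by linarith)
  have hE0 := exp_pos (-u)
  set E := exp (-u)
  have hE8 : E * (17 / 2) ≤ 1 := by nlinarith
  have hcs : cos L + β * sin L ≤ 2 := by nlinarith [cos_le_one L, sin_le_one L]
  have hEc : E * (cos L + β * sin L) ≤ 1 / 2 := by nlinarith
  have hr : u < 2 * u / (1 + β ^ 2) := by
    rw [lt_div_iff₀ (by positivity), mul_comm 2]
    exact mul_lt_mul_of_pos_left (by nlinarith) (by linarith)
  have hmain : 3 * (1 / 2) < 2 * u / (1 + β ^ 2) * (1 - E * (cos L + β * sin L)) := by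
    nlinarith
  have hLE : 0 ≤ L * E * sin L := by positivity
  linarith [sin_sq_le_one L]

lemma gapDerivNumerator_pos_of_one_lt {β : ℝ} (hβ : 1 < β) (h' : β ^ 2 < 3) :
    0 < gapDerivNumerator β := by
  have hπ3 := pi_gt_three
  have hL0 := scaledPeriod_pos β
  have hL1 : 1 * π < scaledPeriod β := lt_scaledPeriod_iff.2 (by linarith)
  have hL2 : scaledPeriod β < 2 * π := scaledPeriod_lt_iff.2 (by nlinarith)
  have hLb : scaledPeriod β * (1 + β ^ 2) = 4 * π := by
    rw [scaledPeriod]; field_simp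
  rw [gapDerivNumerator]
  set L := scaledPeriod β
  have hs : sin L ≤ 0 := by
    rw [← sin_sub_two_pi]
    exact sin_nonpos_of_nonpos_of_neg_pi_le (by linarith) (by linarith)
  set u := β * L with hu
  have hβ2 : β < 7 / 4 := by nlinarith
  have hu5 : 5 < u := by
    have : 5 * (1 + β ^ 2) < u * (1 + β ^ 2) := by
      have e : u * (1 + β ^ 2) = 4 * π * β := by rw [hu, mul_assoc, hLb]; ring
      rw [e]
      nlinarith [pi_gt_d2]
    exact lt_of_mul_lt_mul_right this (by positivity)
  have hLu : L ≤ u := by rw [hu]; nlinarith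
  have hE := exp_neg_mul_le (u := u) (by linarith)
  have hE0 := exp_pos (-u)
  set E := exp (-u)
  have hE18 : E * 18 ≤ 1 := by nlinarith
  have huE : u * E * (7 / 2) ≤ 1 := by nlinarith
  have hcs : cos L + β * sin L ≤ 1 := by nlinarith [cos_le_one L]
  have hEc : E * (cos L + β * sin L) ≤ 1 / 18 := by nlinarith
  have hr : u / 2 < 2 * u / (1 + β ^ 2) := by
    rw [lt_div_iff₀ (by positivity)]; nlinarith
  have hmain : 5 / 2 * (17 / 18) < 2 * u / (1 + β ^ 2) * (1 - E * (cos L + β * sin L)) := by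
    nlinarith
  have hLE : -(u * E) ≤ L * E * sin L := by
    have h1 : L * E ≤ u * E := by gcongr
    have h2 : 0 ≤ L * E := by positivity
    nlinarith [neg_one_le_sin L]
  linarith [sin_sq_le_one L]

/-- There exist `0 < β₀ < β₂ < β₃` such that for every `β > 0` the number of solutions
`θ ∈ (0,2π)` of `K_β(θ) = K_β(0)` is exactly 3 on `(0,β₀)`, exactly 2 on `[β₀,β₂)`,
exactly 1 on `[β₂,β₃)`, and 0 on `[β₃,∞)`. -/
theorem number_of_solutions_K_eq_K0 :
    ∃ β₀ β₂ β₃ : ℝ, 0 < β₀ ∧ β₀ < β₂ ∧ β₂ < β₃ ∧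
      ∀ β : ℝ, 0 < β →
        (β < β₀ →
          {θ : ℝ | θ ∈ Set.Ioo 0 (2*Real.pi) ∧ Kker β θ = Kker β 0}.encard = 3) ∧
        (β₀ ≤ β → β < β₂ →
          {θ : ℝ | θ ∈ Set.Ioo 0 (2*Real.pi) ∧ Kker β θ = Kker β 0}.encard = 2) ∧
        (β₂ ≤ β → β < β₃ →
          {θ : ℝ | θ ∈ Set.Ioo 0 (2*Real.pi) ∧ Kker β θ = Kker β 0}.encard = 1) ∧
        (β₃ ≤ β →
          {θ : ℝ | θ ∈ Set.Ioo 0 (2*Real.pi) ∧ Kker β θ = Kker β 0}.encard = 0) := by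
  have h30 : (0 : ℝ) < √3 := by positivity
  have h3 : √3 ^ 2 = 3 := sq_sqrt (by norm_num)
  have hi : (√3 / 3) ^ 2 = 1 / 3 := by rw [div_pow, h3]; norm_num
  have hi1 : √3 / 3 < 1 := by nlinarith
  have h31 : 1 < √3 := by nlinarith
  have h7 : √(1 / 7) ^ 2 = 1 / 7 := sq_sqrt (by norm_num)
  have h70 : 0 < √(1 / 7) := by positivity
  have h7i : √(1 / 7) < √3 / 3 := by nlinarith
  have hLi : scaledPeriod (√3 / 3) = (3 : ℕ) * π := by
    rw [scaledPeriod_eq_iff, hi]; norm_num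
  have hL1 : scaledPeriod 1 = (2 : ℕ) * π := by
    rw [scaledPeriod_eq_iff]; norm_num
  have hL3 : scaledPeriod √3 = (1 : ℕ) * π := by
    rw [scaledPeriod_eq_iff, h3]; norm_num
  have hk3 : ∀ β ∈ Set.Ioo 0 (√3 / 3),
      scaledPeriod β ∈ Set.Ioo ((3 : ℕ) * π) (((3 : ℕ) + 1) * π) := by
    rintro β ⟨h0, h1⟩
    exact ⟨lt_scaledPeriod_iff.2 (by push_cast; nlinarith),
      scaledPeriod_lt_iff.2 (by push_cast; nlinarith)⟩
  have hk2 : ∀ β ∈ Set.Ioo (√3 / 3) 1,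
      scaledPeriod β ∈ Set.Ioo ((2 : ℕ) * π) (((2 : ℕ) + 1) * π) := by
    rintro β ⟨h0, h1⟩
    exact ⟨lt_scaledPeriod_iff.2 (by push_cast; nlinarith),
      scaledPeriod_lt_iff.2 (by push_cast; nlinarith)⟩
  have hk1 : ∀ β ∈ Set.Ioo 1 √3,
      scaledPeriod β ∈ Set.Ioo ((1 : ℕ) * π) (((1 : ℕ) + 1) * π) := by
    rintro β ⟨h0, h1⟩
    exact ⟨lt_scaledPeriod_iff.2 (by push_cast; nlinarith),
      scaledPeriod_lt_iff.2 (by push_cast; nlinarith)⟩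
  have hk0 : ∀ β, √3 < β → scaledPeriod β ∈ Set.Ioo ((0 : ℕ) * π) (((0 : ℕ) + 1) * π) := by
    intro β h0
    exact ⟨by simpa using scaledPeriod_pos β, scaledPeriod_lt_iff.2 (by push_cast; nlinarith)⟩
  have hni : gapNumerator (√3 / 3) < 0 := gapNumerator_neg_of_eq_mul_pi (by decide) hLi
  have hn3 : gapNumerator √3 < 0 := gapNumerator_neg_of_eq_mul_pi (by decide) hL3
  obtain ⟨β₀, hβ₀, H₀⟩ := exists_threshold hk3
    (fun β hβ => gapDerivNumerator_pos_of_sq_lt hβ.1 (by nlinarith [hβ.1, hβ.2]))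
    (p := √3 / 3) (q := √(1 / 7)) ⟨by positivity, le_rfl⟩ ⟨h70.le, h7i.le⟩ hni
    (gapNumerator_pos_of_sq_eq h70 h7)
  obtain ⟨β₂, hβ₂, H₂⟩ := exists_threshold hk2
    (fun β hβ => gapDerivNumerator_pos_of_lt_one (lt_trans (by positivity) hβ.1)
      (by nlinarith [hβ.1]) hβ.2)
    (Set.left_mem_Icc.2 hi1.le) (Set.right_mem_Icc.2 hi1.le) hni gapNumerator_one_pos
  obtain ⟨β₃, hβ₃, H₃⟩ := exists_threshold hk1
    (fun β hβ => gapDerivNumerator_pos_of_one_lt hβ.1 (by nlinarith [hβ.1, hβ.2]))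
    (Set.right_mem_Icc.2 h31.le) (Set.left_mem_Icc.2 h31.le) hn3 gapNumerator_one_pos
  refine ⟨β₀, β₂, β₃, hβ₀.1, hβ₀.2.trans hβ₂.1, hβ₂.2.trans hβ₃.1, fun β hβ => ⟨?_, ?_, ?_, ?_⟩⟩
  · intro h
    have hm : β ∈ Set.Ioo 0 (√3 / 3) := ⟨hβ, h.trans hβ₀.2⟩
    simpa using encard_solutions_of_gap_neg hβ (hk3 β hm) ((H₀ β hm).1 h)
  · intro h h'
    rcases lt_trichotomy β (√3 / 3) with hlt | rfl | hgt
    · simpa using encard_solutions_of_gap_nonneg hβ (hk3 β ⟨hβ, hlt⟩) ((H₀ β ⟨hβ, hlt⟩).2 h)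
    · simpa using encard_solutions_of_eq_mul_pi hβ hLi
    · have hm : β ∈ Set.Ioo (√3 / 3) 1 := ⟨hgt, h'.trans hβ₂.2⟩
      simpa using encard_solutions_of_gap_neg hβ (hk2 β hm) ((H₂ β hm).1 h')
  · intro h h'
    rcases lt_trichotomy β 1 with hlt | rfl | hgt
    · have hm : β ∈ Set.Ioo (√3 / 3) 1 := ⟨hβ₂.1.trans_le h, hlt⟩
      simpa using encard_solutions_of_gap_nonneg hβ (hk2 β hm) ((H₂ β hm).2 h)
    · simpa using encard_solutions_of_eq_mul_pi hβ hL1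
    · have hm : β ∈ Set.Ioo 1 √3 := ⟨hgt, h'.trans hβ₃.2⟩
      simpa using encard_solutions_of_gap_neg hβ (hk1 β hm) ((H₃ β hm).1 h')
  · intro h
    rcases lt_trichotomy β √3 with hlt | rfl | hgt
    · have hm : β ∈ Set.Ioo 1 √3 := ⟨hβ₃.1.trans_le h, hlt⟩
      simpa using encard_solutions_of_gap_nonneg hβ (hk1 β hm) ((H₃ β hm).2 h)
    · simpa using encard_solutions_of_eq_mul_pi hβ hL3
    · refine (encard_solutions_eq_level hβ (hk0 β hgt)).trans ?_
      simp
end
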